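/- Let n ≥ 2 and let Γ = Cay(I(n), S) with S = (X ∪ Y) \ {0}. For distinct x, x' ∈ X \ {0} and distinct y, y' ∈ Y \ {0}, the set of vertices at distance two from the identity 0 in Γ is exactly {x + y : x ∈ X\{0}, y ∈ Y\{0}} ∪ {x + y + x⊗y : x ∈ X\{0}, y ∈ Y\{0}}. -/

import Mathlib

open TensorProduct

/-- `X = F_2^n`, the `n`-dimensional vector space over `F_2`. -/
abbrev Vn (n : ℕ) := Fin n → ZMod 2

/-- The tensor product `X ⊗ Y` over `F_2`. -/
abbrev Tn (n : ℕ) := TensorProduct (ZMod 2) (Vn n) (Vn n)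

/-- The underlying set `X ⊕ Y ⊕ (X ⊗ Y)` of the group `I(n)` of
Definition `concreteConstruction`. -/
def ICarrier (n : ℕ) := Vn n × Vn n × Tn n

lemma char2_add_self {M : Type*} [AddCommGroup M] [Module (ZMod 2) M] (a : M) :
    a + a = 0 := by
  have h : (2 : ZMod 2) • a = a + a := two_smul _ a
  rw [show (2 : ZMod 2) = 0 by decide, zero_smul] at h
  exact h.symm

namespace ICarrier

variable {n : ℕ}

noncomputable instance : AddCommGroup (ICarrier n) :=
  inferInstanceAs (AddCommGroup (Vn n × Vn n × Tn n))

noncomputable instance : Module (ZMod 2) (ICarrier n) :=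
  inferInstanceAs (Module (ZMod 2) (Vn n × Vn n × Tn n))

/-- The element `x + y + A` of `I(n)`. -/
def mk (x y : Vn n) (A : Tn n) : ICarrier n := (x, y, A)

/-- The `X`-component of an element of `I(n)`. -/
def x (p : ICarrier n) : Vn n := Prod.fst p

/-- The `Y`-component of an element of `I(n)`. -/
def y (p : ICarrier n) : Vn n := (Prod.snd p).1

/-- The `X ⊗ Y`-component of an element of `I(n)`. -/
def A (p : ICarrier n) : Tn n := (Prod.snd p).2

@[ext] lemma ext {p q : ICarrier n} (h1 : p.x = q.x) (h2 : p.y = q.y)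
    (h3 : p.A = q.A) : p = q :=
  Prod.ext h1 (Prod.ext h2 h3)

@[simp] lemma x_add (p q : ICarrier n) : (p + q).x = p.x + q.x := rfl
@[simp] lemma y_add (p q : ICarrier n) : (p + q).y = p.y + q.y := rfl
@[simp] lemma A_add (p q : ICarrier n) : (p + q).A = p.A + q.A := rfl
@[simp] lemma x_mk (a b : Vn n) (c : Tn n) : (mk a b c).x = a := rfl
@[simp] lemma y_mk (a b : Vn n) (c : Tn n) : (mk a b c).y = b := rfl
@[simp] lemma A_mk (a b : Vn n) (c : Tn n) : (mk a b c).A = c := rfl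
@[simp] lemma x_zero : (0 : ICarrier n).x = 0 := rfl
@[simp] lemma y_zero : (0 : ICarrier n).y = 0 := rfl
@[simp] lemma A_zero : (0 : ICarrier n).A = 0 := rfl

/-- Multiplication in `I(n)`: `g₁g₂ = g₁ + g₂ + x₂ ⊗ y₁` (Equation `eqnMultiplication`). -/
noncomputable instance : Mul (ICarrier n) :=
  ⟨fun p q => p + q + mk 0 0 (q.x ⊗ₜ[ZMod 2] p.y)⟩

noncomputable instance : One (ICarrier n) := ⟨(0 : ICarrier n)⟩

/-- Inversion in `I(n)`: `g⁻¹ = g + x ⊗ y` (Equation `eqnInverse`). -/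
noncomputable instance : Inv (ICarrier n) :=
  ⟨fun p => p + mk 0 0 (p.x ⊗ₜ[ZMod 2] p.y)⟩

lemma mul_def (p q : ICarrier n) :
    p * q = p + q + mk 0 0 (q.x ⊗ₜ[ZMod 2] p.y) := rfl

lemma one_def : (1 : ICarrier n) = 0 := rfl

lemma inv_def (p : ICarrier n) :
    p⁻¹ = p + mk 0 0 (p.x ⊗ₜ[ZMod 2] p.y) := rfl

@[simp] lemma x_mul (p q : ICarrier n) : (p * q).x = p.x + q.x := by
  show p.x + q.x + 0 = _; rw [add_zero]
@[simp] lemma y_mul (p q : ICarrier n) : (p * q).y = p.y + q.y := by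
  show p.y + q.y + 0 = _; rw [add_zero]
@[simp] lemma A_mul (p q : ICarrier n) :
    (p * q).A = p.A + q.A + q.x ⊗ₜ[ZMod 2] p.y := rfl

@[simp] lemma x_inv (p : ICarrier n) : (p⁻¹).x = p.x := by
  show p.x + 0 = _; rw [add_zero]
@[simp] lemma y_inv (p : ICarrier n) : (p⁻¹).y = p.y := by
  show p.y + 0 = _; rw [add_zero]
@[simp] lemma A_inv (p : ICarrier n) :
    (p⁻¹).A = p.A + p.x ⊗ₜ[ZMod 2] p.y := rfl

noncomputable instance : Group (ICarrier n) :=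
  Group.ofLeftAxioms
    (fun p q r => by
      apply ext <;>
        simp [TensorProduct.add_tmul, TensorProduct.tmul_add] <;> abel)
    (fun p => by
      apply ext <;> simp [one_def, TensorProduct.tmul_zero])
    (fun p => by
      apply ext
      · simp [one_def, char2_add_self]
      · simp [one_def, char2_add_self]
      · simp only [A_mul, A_inv, y_inv, one_def, A_zero]
        calc p.A + p.x ⊗ₜ[ZMod 2] p.y + p.A + p.x ⊗ₜ[ZMod 2] p.y
            = (p.A + p.A) + (p.x ⊗ₜ[ZMod 2] p.y + p.x ⊗ₜ[ZMod 2] p.y) := by abel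
          _ = 0 := by rw [char2_add_self, char2_add_self, add_zero])

end ICarrier

/-- The connection set `S = (X ∪ Y) \ {0}` of the Cayley graph `Γ(n) = Cay(I(n), S)`. -/
def SConn (n : ℕ) : Set (ICarrier n) :=
  ({p | p.y = 0 ∧ p.A = 0} ∪ {p | p.x = 0 ∧ p.A = 0}) \ {0}

/-- The Cayley graph `Γ(n) = Cay(I(n), (X ∪ Y) \ {0})`: edges are the pairs `{g, sg}`
with `s ∈ S`. -/
noncomputable def cayI (n : ℕ) : SimpleGraph (ICarrier n) :=
  SimpleGraph.fromRel (fun a b => b * a⁻¹ ∈ SConn n)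

lemma mem_SConn_iff {n : ℕ} (p : ICarrier n) :
    p ∈ SConn n ↔ (∃ x : Vn n, x ≠ 0 ∧ p = ICarrier.mk x 0 0) ∨
      (∃ y : Vn n, y ≠ 0 ∧ p = ICarrier.mk 0 y 0) := by
  constructor
  · rintro ⟨h | h, h0⟩
    · refine Or.inl ⟨p.x, fun hx => h0 (ICarrier.ext hx h.1 h.2), ICarrier.ext rfl h.1 h.2⟩
    · refine Or.inr ⟨p.y, fun hy => h0 (ICarrier.ext h.1 hy h.2), ICarrier.ext h.1 rfl h.2⟩
  · rintro (⟨x, hx, rfl⟩ | ⟨y, hy, rfl⟩)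
    · exact ⟨Or.inl ⟨rfl, rfl⟩, fun h => hx (congrArg ICarrier.x h)⟩
    · exact ⟨Or.inr ⟨rfl, rfl⟩, fun h => hy (congrArg ICarrier.y h)⟩

lemma SConn_inv {n : ℕ} {p : ICarrier n} (h : p ∈ SConn n) : p⁻¹ = p := by
  rcases (mem_SConn_iff p).1 h with ⟨x, hx, rfl⟩ | ⟨y, hy, rfl⟩ <;>
    apply ICarrier.ext <;> simp

lemma cayI_adj {n : ℕ} (a b : ICarrier n) :
    (cayI n).Adj a b ↔ ∃ s ∈ SConn n, b = s * a := by
  unfold cayI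
  rw [SimpleGraph.fromRel_adj]
  constructor
  · rintro ⟨-, h | h⟩
    · exact ⟨_, h, by group⟩
    · refine ⟨_, h, ?_⟩
      have h2 := SConn_inv h
      rw [← h2]
      group
  · rintro ⟨s, hs, rfl⟩
    refine ⟨fun h => hs.2 ?_, Or.inl (by simpa using hs)⟩
    exact mul_eq_right.1 h.symm

lemma cayI_adj_zero {n : ℕ} (b : ICarrier n) :
    (cayI n).Adj 0 b ↔ b ∈ SConn n := by
  rw [cayI_adj, ← ICarrier.one_def]
  simp

lemma cayI_dist_two {n : ℕ} (p : ICarrier n) :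
    (cayI n).dist 0 p = 2 ↔ p ≠ 0 ∧ p ∉ SConn n ∧
      ∃ s ∈ SConn n, ∃ t ∈ SConn n, p = t * s := by
  constructor
  · intro h
    refine ⟨?_, ?_, ?_⟩
    · rintro rfl
      simp at h
    · intro hp
      have := SimpleGraph.dist_eq_one_iff_adj.2 ((cayI_adj_zero p).2 hp)
      omega
    · obtain ⟨w, hw⟩ := SimpleGraph.exists_walk_of_dist_ne_zero (G := cayI n)
        (u := 0) (v := p) (by omega)
      rw [h] at hw
      match w, hw with
      | .cons h1 (.cons h2 .nil), _ =>
        obtain ⟨t, ht, e⟩ := (cayI_adj _ _).1 h2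
        exact ⟨_, (cayI_adj_zero _).1 h1, t, ht, e⟩
  · rintro ⟨h0, hS, s, hs, t, ht, e⟩
    have h1 := (cayI_adj_zero s).2 hs
    have h2 : (cayI n).Adj s p := (cayI_adj _ _).2 ⟨t, ht, e⟩
    have hle := SimpleGraph.dist_le (SimpleGraph.Walk.cons h1 (.cons h2 .nil))
    simp only [SimpleGraph.Walk.length_cons, SimpleGraph.Walk.length_nil] at hle
    have hr : (cayI n).Reachable 0 p := h1.reachable.trans h2.reachable
    have n0 : (cayI n).dist 0 p ≠ 0 := fun h => h0 (hr.dist_eq_zero_iff.1 h).symm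
    have n1 : (cayI n).dist 0 p ≠ 1 := fun h =>
      hS ((cayI_adj_zero p).1 (SimpleGraph.dist_eq_one_iff_adj.1 h))
    omega

lemma mk_not_small {n : ℕ} {x y : Vn n} (hx : x ≠ 0) (hy : y ≠ 0) (A : Tn n) :
    ICarrier.mk x y A ≠ 0 ∧ ICarrier.mk x y A ∉ SConn n := by
  refine ⟨fun h => hx (congrArg ICarrier.x h), ?_⟩
  rintro ⟨h | h, -⟩
  · exact hy h.1
  · exact hx h.1

/-- For `n ≥ 2`, the set of vertices at distance two from the identity `0`
in `Γ = Cay(I(n), (X ∪ Y) \ {0})` is exactly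
`{x + y : x ∈ X\{0}, y ∈ Y\{0}} ∪ {x + y + x⊗y : x ∈ X\{0}, y ∈ Y\{0}}`. -/
theorem statement18 (n : ℕ) (hn : 2 ≤ n) :
    {p : ICarrier n | (cayI n).dist 0 p = 2} =
      {p : ICarrier n | ∃ x y : Vn n, x ≠ 0 ∧ y ≠ 0 ∧ p = ICarrier.mk x y 0} ∪
      {p : ICarrier n | ∃ x y : Vn n, x ≠ 0 ∧ y ≠ 0 ∧
        p = ICarrier.mk x y (x ⊗ₜ[ZMod 2] y)} := by
  ext p
  simp only [Set.mem_ofPred_eq, Set.mem_union]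
  rw [cayI_dist_two]
  constructor
  · rintro ⟨h0, hS, s, hs, t, ht, e⟩
    rcases (mem_SConn_iff s).1 hs with ⟨x, hx, rfl⟩ | ⟨y, hy, rfl⟩ <;>
    rcases (mem_SConn_iff t).1 ht with ⟨x', hx', rfl⟩ | ⟨y', hy', rfl⟩
    · refine absurd ⟨Or.inl ⟨?_, ?_⟩, h0⟩ hS <;> simp [e]
    · refine Or.inr ⟨x, y', hx, hy', ?_⟩
      rw [e]
      apply ICarrier.ext <;> simp
    · refine Or.inl ⟨x', y, hx', hy, ?_⟩
      rw [e]
      apply ICarrier.ext <;> simp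
    · refine absurd ⟨Or.inr ⟨?_, ?_⟩, h0⟩ hS <;> simp [e]
  · rintro (⟨x, y, hx, hy, rfl⟩ | ⟨x, y, hx, hy, rfl⟩)
    · refine ⟨(mk_not_small hx hy _).1, (mk_not_small hx hy _).2,
        _, (mem_SConn_iff _).2 (Or.inr ⟨y, hy, rfl⟩),
        _, (mem_SConn_iff _).2 (Or.inl ⟨x, hx, rfl⟩), ?_⟩
      apply ICarrier.ext <;> simp
    · refine ⟨(mk_not_small hx hy _).1, (mk_not_small hx hy _).2,
        _, (mem_SConn_iff _).2 (Or.inl ⟨x, hx, rfl⟩),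
        _, (mem_SConn_iff _).2 (Or.inr ⟨y, hy, rfl⟩), ?_⟩
      apply ICarrier.ext <;> simp
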